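/- arXiv:2411.05385 — 5 statements merged into one kernel-verified Lean document; each statement's English description precedes it below -/
import Mathlib

section
/- Let K ∈ ℂ^{n×n} with n = n₁+⋯+n_d, let c ∈ ℂ be nonzero, and define p(U₁,…,U_d) = c·det(I_n ⊗ I_m − (K ⊗ I_m)(⊕_{j=1}^d I_{n_j} ⊗ U_j)) for U₁,…,U_d ∈ ℂ^{m×m}, m ∈ ℕ. Then the following are equivalent: (i) p(U₁,…,U_d) ≠ 0 for all d-tuples of m×m unitary matrices (U₁,…,U_d) and all m ∈ ℕ; (ii) p(U₁,…,U_d) ≠ 0 for all d-tuples of m×m unitary matrices with m = 1,…,n; (iii) there exists an invertible block diagonal matrix S = ⊕_{j=1}^d S_j with S_j ∈ ℂ^{n_j×n_j} such that S⁻¹KS is a strict J-contraction for some diagonal signature matrix J. -/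
open Matrix Kronecker
open scoped ComplexOrder

/-- The index type for the block decomposition `n = n₁ + ⋯ + n_d`:
`BIdx nn ≃ Fin (n₁ + ⋯ + n_d)`. -/
abbrev BIdx {d : ℕ} (nn : Fin d → ℕ) : Type := (j : Fin d) × Fin (nn j)

/-- The block diagonal matrix `⊕_{j=1}^d I_{n_j} ⊗ U_j` acting on `ℂ^{n m}`. -/
def oplusKron {d : ℕ} (nn : Fin d → ℕ) {m : ℕ}
    (U : ∀ _ : Fin d, Matrix (Fin m) (Fin m) ℂ) :
    Matrix (BIdx nn × Fin m) (BIdx nn × Fin m) ℂ :=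
  fun p q => if p.1 = q.1 then U p.1.1 p.2 q.2 else 0

/-- `p(U₁,…,U_d) = c · det(I_n ⊗ I_m − (K ⊗ I_m)(⊕_{j=1}^d I_{n_j} ⊗ U_j))`. -/
noncomputable def ncDet {d : ℕ} (nn : Fin d → ℕ)
    (K : Matrix (BIdx nn) (BIdx nn) ℂ) (c : ℂ) {m : ℕ}
    (U : ∀ _ : Fin d, Matrix (Fin m) (Fin m) ℂ) : ℂ :=
  c * Matrix.det ((1 : Matrix (BIdx nn × Fin m) (BIdx nn × Fin m) ℂ) -
      (K ⊗ₖ (1 : Matrix (Fin m) (Fin m) ℂ)) * oplusKron nn U)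

/-- A diagonal signature matrix: a diagonal matrix with each diagonal entry `1` or `-1`. -/
def IsDiagSignature {ι : Type*} [DecidableEq ι] (J : Matrix ι ι ℂ) : Prop :=
  ∃ e : ι → ℂ, (∀ i, e i = 1 ∨ e i = -1) ∧ J = Matrix.diagonal e

/-- There is an invertible block diagonal `S = ⊕_{j=1}^d S_j` such that `S⁻¹ K S` is a
strict `J`-contraction (`J - (S⁻¹KS) J (S⁻¹KS)* ≻ 0`) for some diagonal signature matrix `J`. -/
noncomputable def StructSimStrictContr {d : ℕ} (nn : Fin d → ℕ)
    (K : Matrix (BIdx nn) (BIdx nn) ℂ) : Prop :=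
  ∃ S : ∀ j : Fin d, Matrix (Fin (nn j)) (Fin (nn j)) ℂ,
    IsUnit (Matrix.blockDiagonal' S) ∧
    ∃ J : Matrix (BIdx nn) (BIdx nn) ℂ, IsDiagSignature J ∧
      (J - ((Matrix.blockDiagonal' S)⁻¹ * K * Matrix.blockDiagonal' S) * J *
        ((Matrix.blockDiagonal' S)⁻¹ * K * Matrix.blockDiagonal' S)ᴴ).PosDef

lemma exists_linearIsometry_comp_eq {E V : Type*} [AddCommGroup E] [Module ℂ E]
    [NormedAddCommGroup V] [InnerProductSpace ℂ V] [FiniteDimensional ℂ V]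
    (a b : E →ₗ[ℂ] V) (h : ∀ x, ‖a x‖ = ‖b x‖) :
    ∃ L : V →ₗᵢ[ℂ] V, ∀ x, L (b x) = a x := by
  obtain ⟨g, hg⟩ := LinearMap.exists_rightInverse_of_surjective b.rangeRestrict
    (LinearMap.range_rangeRestrict b)
  have hbg (y : LinearMap.range b) : b (g y) = y :=
    congrArg Subtype.val (LinearMap.congr_fun hg y)
  let L₀ : LinearMap.range b →ₗᵢ[ℂ] V :=
    ⟨a ∘ₗ g, fun y => by
      rw [LinearMap.comp_apply, h, hbg]; rfl⟩
  refine ⟨L₀.extend, fun x => ?_⟩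
  have hx := L₀.extend_apply (b.rangeRestrict x)
  rw [LinearMap.codRestrict_apply] at hx
  refine hx.trans ?_
  change a (g (b.rangeRestrict x)) = a x
  rw [← sub_eq_zero, ← map_sub, ← norm_eq_zero, h, map_sub, hbg]
  simp

lemma norm_sq_toEuclideanLin {m k : Type*} [Fintype m] [Fintype k] [DecidableEq k]
    (A : Matrix m k ℂ) (x : EuclideanSpace ℂ k) :
    ((‖toEuclideanLin A x‖ ^ 2 : ℝ) : ℂ) = star x.ofLp ⬝ᵥ (Aᴴ * A) *ᵥ x.ofLp := by
  have := inner_self_eq_norm_sq_to_K (𝕜 := ℂ) (toEuclideanLin A x)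
  push_cast
  refine this.symm.trans ?_
  rw [EuclideanSpace.inner_eq_star_dotProduct, ← mulVec_mulVec, dotProduct_mulVec,
    ← star_mulVec, dotProduct_comm]
  rfl

lemma conjTranspose_mul_self_eq_one_of_isometry {m : Type*} [Fintype m] [DecidableEq m]
    (L : EuclideanSpace ℂ m →ₗᵢ[ℂ] EuclideanSpace ℂ m) :
    (toEuclideanLin.symm L.toLinearMap)ᴴ * toEuclideanLin.symm L.toLinearMap =
      (1 : Matrix m m ℂ) := by
  set M : Matrix m m ℂ := toEuclideanLin.symm L.toLinearMap with hM
  have hL (x) : toEuclideanLin M x = L x := by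
    rw [hM, LinearEquiv.apply_symm_apply]; rfl
  ext i j
  have h := L.inner_map_map (EuclideanSpace.single i 1) (EuclideanSpace.single j 1)
  rw [← hL, ← hL, EuclideanSpace.inner_eq_star_dotProduct] at h
  have h1 : inner ℂ (EuclideanSpace.single i (1 : ℂ)) (EuclideanSpace.single j (1 : ℂ)) =
      (1 : Matrix m m ℂ) i j := by
    simp [EuclideanSpace.inner_single_left, one_apply]
  rw [← h1, ← h, mul_apply, dotProduct]
  simp [toEuclideanLin, mul_comm]

lemma exists_unitary_mul_eq {m k : Type*} [Fintype m] [Fintype k] [DecidableEq m]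
    (A B : Matrix m k ℂ) (h : Aᴴ * A = Bᴴ * B) :
    ∃ U ∈ unitaryGroup m ℂ, A = U * B := by
  classical
  obtain ⟨L, hL⟩ := exists_linearIsometry_comp_eq (toEuclideanLin A) (toEuclideanLin B)
    (fun x => by
      have h2 : ((‖toEuclideanLin A x‖ ^ 2 : ℝ) : ℂ) = ((‖toEuclideanLin B x‖ ^ 2 : ℝ) : ℂ) := by
        rw [norm_sq_toEuclideanLin, norm_sq_toEuclideanLin, h]
      exact (sq_eq_sq₀ (norm_nonneg _) (norm_nonneg _)).1 (Complex.ofReal_injective h2))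
  refine ⟨toEuclideanLin.symm L.toLinearMap,
    mem_unitaryGroup_iff'.2 (conjTranspose_mul_self_eq_one_of_isometry L), ?_⟩
  apply toEuclideanLin.injective
  ext x : 1
  rw [← hL]
  have h3 : L (toEuclideanLin B x) =
      toEuclideanLin (toEuclideanLin.symm L.toLinearMap) (toEuclideanLin B x) := by
    rw [LinearEquiv.apply_symm_apply]; rfl
  rw [h3]
  simp [toEuclideanLin, Matrix.toLpLin_apply]

open scoped MatrixOrder in
lemma Matrix.PosSemidef.exists_eq_conjTranspose_mul_self {ι : Type*} [Fintype ι] [DecidableEq ι]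
    {X : Matrix ι ι ℂ} (hX : X.PosSemidef) : ∃ B : Matrix ι ι ℂ, X = Bᴴ * B :=
  CStarAlgebra.nonneg_iff_eq_star_mul_self.1 hX.nonneg

/-- The positive semidefinite matrices of trace one. -/
def densityMatrices (ι : Type*) [Fintype ι] : Set (Matrix ι ι ℂ) :=
  {X | X.PosSemidef ∧ X.trace = 1}

lemma isCompact_densityMatrices {ι : Type*} [Fintype ι] [DecidableEq ι] :
    IsCompact (densityMatrices ι) := by
  have hS : IsCompact (Metric.sphere (0 : EuclideanSpace ℂ (ι × ι)) 1) := isCompact_sphere _ _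
  have hc : Continuous fun y : EuclideanSpace ℂ (ι × ι) =>
      (Matrix.of fun i j => y (i, j))ᴴ * (Matrix.of fun i j => y (i, j)) := by
    apply Continuous.matrix_mul
    · apply Continuous.matrix_conjTranspose
      exact continuous_matrix fun i j => by simp only [of_apply]; fun_prop
    · exact continuous_matrix fun i j => by simp only [of_apply]; fun_prop
  have htr (y : EuclideanSpace ℂ (ι × ι)) :
      ((Matrix.of fun i j => y (i, j))ᴴ * (Matrix.of fun i j => y (i, j))).trace =
        ((‖y‖ ^ 2 : ℝ) : ℂ) := by
    rw [EuclideanSpace.norm_sq_eq, Fintype.sum_prod_type, Finset.sum_comm]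
    simp [trace, mul_apply, Complex.conj_mul']
  convert hS.image hc using 1
  ext X
  constructor
  · rintro ⟨h0, h1⟩
    obtain ⟨B, rfl⟩ := h0.exists_eq_conjTranspose_mul_self
    refine ⟨WithLp.toLp 2 fun p => B p.1 p.2, ?_, rfl⟩
    have := htr (WithLp.toLp 2 fun p => B p.1 p.2)
    have h2 := this.symm.trans h1
    rw [Complex.ofReal_eq_one, pow_eq_one_iff_of_nonneg (norm_nonneg _) two_ne_zero] at h2
    exact mem_sphere_zero_iff_norm.2 h2
  · rintro ⟨y, hy, rfl⟩
    refine ⟨posSemidef_conjTranspose_mul_self _, ?_⟩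
    rw [htr, mem_sphere_zero_iff_norm.1 hy]; simp

lemma re_trace_conjTranspose_mul_self_nonneg {ι κ : Type*} [Fintype ι] [Fintype κ]
    (A : Matrix κ ι ℂ) : 0 ≤ (Aᴴ * A).trace.re :=
  (Complex.nonneg_iff.1 (posSemidef_conjTranspose_mul_self A).trace_nonneg).1

lemma nonneg_of_forall_two_mul_add_sq_mul {a b : ℝ}
    (h : ∀ t : ℝ, 0 < t → t ≤ 1 → 0 ≤ 2 * t * a + t ^ 2 * b) : 0 ≤ a := by
  by_contra! ha
  have hb : 0 < |b| - a + 1 := by linarith [abs_nonneg b]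
  have ht0 : 0 < -a / (|b| - a + 1) := div_pos (by linarith) hb
  have ht := h _ ht0 (by rw [div_le_one hb]; linarith [abs_nonneg b])
  have hmul : -a / (|b| - a + 1) * (|b| - a + 1) = -a := div_mul_cancel₀ _ hb.ne'
  set t := -a / (|b| - a + 1)
  have hpos : 0 ≤ 2 * a + t * b := by
    by_contra! hneg
    nlinarith
  nlinarith [le_abs_self b]

lemma exists_density_minimizer {ι κ : Type*} [Fintype ι] [DecidableEq ι] [Nonempty ι] [Fintype κ]
    (T : Matrix ι ι ℂ →ₗ[ℂ] Matrix κ κ ℂ) :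
    ∃ X₀ ∈ densityMatrices ι, ∀ X ∈ densityMatrices ι,
      ((T X₀)ᴴ * T X₀).trace.re ≤ ((T X₀)ᴴ * T X).trace.re := by
  have hT : Continuous T := T.continuous_of_finiteDimensional
  have hne : (densityMatrices ι).Nonempty := by
    obtain ⟨i⟩ := ‹Nonempty ι›
    exact ⟨vecMulVec (Pi.single i 1) (star (Pi.single i 1)), posSemidef_vecMulVec_self_star _,
      by rw [trace_vecMulVec]; simp⟩
  obtain ⟨X₀, h₀, hmin⟩ := isCompact_densityMatrices.exists_isMinOn hne
    (f := fun X => ((T X)ᴴ * T X).trace.re) (by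
      apply Continuous.continuousOn
      fun_prop)
  refine ⟨X₀, h₀, fun X hX => ?_⟩
  rw [← sub_nonneg]
  apply nonneg_of_forall_two_mul_add_sq_mul (b := ((T (X - X₀))ᴴ * T (X - X₀)).trace.re)
  intro t ht0 ht1
  have hmem : (((1 - t : ℝ) : ℂ) • X₀ + (t : ℂ) • X) ∈ densityMatrices ι := by
    refine ⟨(h₀.1.smul ?_).add (hX.1.smul ?_), ?_⟩
    · exact_mod_cast sub_nonneg.2 ht1
    · exact_mod_cast ht0.le
    · simp [trace_add, h₀.2, hX.2]
  have key := hmin hmem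
  have hre : (((1 - t : ℝ) : ℂ) • X₀ + (t : ℂ) • X) = X₀ + (t : ℂ) • (X - X₀) := by
    push_cast; module
  have hsym : ((T (X - X₀))ᴴ * T X₀).trace.re = ((T X₀)ᴴ * T (X - X₀)).trace.re := by
    have : ((T (X - X₀))ᴴ * T X₀) = ((T X₀)ᴴ * T (X - X₀))ᴴ := by simp
    rw [this, trace_conjTranspose]; simp
  simp only [Set.mem_ofPred_eq] at key
  rw [hre, map_add, map_smul] at key
  set Z := T (X - X₀) with hZ
  have hTX : T X = T X₀ + Z := by rw [hZ, map_sub]; abel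
  rw [hTX]
  simp [add_mul, mul_add, trace_add, hsym] at key ⊢
  nlinarith

lemma exists_re_dotProduct_mul_conjTranspose_le {ι : Type*} [Fintype ι] [DecidableEq ι]
    (K : Matrix ι ι ℂ) : ∃ C : ℝ, 0 ≤ C ∧ ∀ v : ι → ℂ,
      (star v ⬝ᵥ (K * Kᴴ) *ᵥ v).re ≤ C * (star v ⬝ᵥ v).re := by
  set F := LinearMap.toContinuousLinearMap (toEuclideanLin Kᴴ) with hF
  refine ⟨‖F‖ ^ 2, sq_nonneg _, fun v => ?_⟩
  have h1 := norm_sq_toEuclideanLin Kᴴ (WithLp.toLp 2 v)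
  have h2 := norm_sq_toEuclideanLin (1 : Matrix ι ι ℂ) (WithLp.toLp 2 v)
  rw [conjTranspose_conjTranspose] at h1
  rw [conjTranspose_one, one_mul, one_mulVec] at h2
  have h3 : toEuclideanLin (1 : Matrix ι ι ℂ) (WithLp.toLp 2 v) = WithLp.toLp 2 v := by
    simp [toEuclideanLin]
  rw [← h1, ← h2, h3, Complex.ofReal_re, Complex.ofReal_re, ← mul_pow]
  exact pow_le_pow_left₀ (norm_nonneg _) (F.le_opNorm (WithLp.toLp 2 v)) 2

lemma exists_pos_lt_isUnit_add_smul_one {ι : Type*} [Fintype ι] [DecidableEq ι]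
    (H : Matrix ι ι ℂ) {δ : ℝ} (hδ : 0 < δ) :
    ∃ ε : ℝ, 0 < ε ∧ ε < δ ∧ IsUnit (H + (ε : ℂ) • 1) := by
  have hfin : {z : ℂ | (-H).charpoly.IsRoot z}.Finite :=
    Polynomial.finite_setOfPred_isRoot (charpoly_monic _).ne_zero
  obtain ⟨ε, hε, hroot⟩ := (Set.Ioo_infinite hδ).exists_notMem_finite
    (hfin.preimage Complex.ofReal_injective.injOn)
  refine ⟨ε, hε.1, hε.2, ?_⟩
  rw [isUnit_iff_isUnit_det, isUnit_iff_ne_zero]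
  intro h0
  apply hroot
  change Polynomial.eval _ _ = 0
  rw [eval_charpoly, sub_neg_eq_add, add_comm, ← h0]
  simp [smul_one_eq_diagonal]

section Blocks

variable {d : ℕ} {nn : Fin d → ℕ}

/-- The block diagonal part of `X - Kᴴ X K`. -/
noncomputable def steinBlockPart (K : Matrix (BIdx nn) (BIdx nn) ℂ) :
    Matrix (BIdx nn) (BIdx nn) ℂ →ₗ[ℂ] Matrix (BIdx nn) (BIdx nn) ℂ where
  toFun X := blockDiagonal' (blockDiag' (X - Kᴴ * X * K))
  map_add' X Y := by
    rw [← blockDiagonal'_add, ← blockDiag'_add]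
    congr 2; noncomm_ring
  map_smul' z X := by
    rw [RingHom.id_apply, ← blockDiagonal'_smul, ← blockDiag'_smul]
    congr 2; simp [smul_sub]

lemma trace_blockDiagonal'_mul_blockDiagonal'_blockDiag'
    (M : ∀ j, Matrix (Fin (nn j)) (Fin (nn j)) ℂ) (X : Matrix (BIdx nn) (BIdx nn) ℂ) :
    (blockDiagonal' M * blockDiagonal' (blockDiag' X)).trace = (blockDiagonal' M * X).trace := by
  rw [trace, trace]
  refine Finset.sum_congr rfl fun a _ => ?_
  simp only [diag_apply, mul_apply]
  refine Finset.sum_congr rfl fun b _ => ?_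
  obtain ⟨i, a⟩ := a
  obtain ⟨j, b⟩ := b
  by_cases h : i = j
  · subst h; simp [blockDiag'_apply]
  · rw [blockDiagonal'_apply_ne _ _ _ h, zero_mul, zero_mul]

lemma trace_blockDiagonal'_mul_steinBlockPart (K : Matrix (BIdx nn) (BIdx nn) ℂ)
    (M : ∀ j, Matrix (Fin (nn j)) (Fin (nn j)) ℂ) (X : Matrix (BIdx nn) (BIdx nn) ℂ) :
    (blockDiagonal' M * steinBlockPart K X).trace =
      ((blockDiagonal' M - K * blockDiagonal' M * Kᴴ) * X).trace := by
  refine (trace_blockDiagonal'_mul_blockDiagonal'_blockDiag' M _).trans ?_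
  rw [mul_sub, sub_mul, trace_sub, trace_sub]
  congr 1
  rw [← mul_assoc, trace_mul_comm]
  simp only [mul_assoc]

lemma isHermitian_sub_mul_mul_conjTranspose {ι : Type*} [Fintype ι] {H : Matrix ι ι ℂ}
    (hH : H.IsHermitian) (K : Matrix ι ι ℂ) : (H - K * H * Kᴴ).IsHermitian :=
  hH.sub (isHermitian_mul_mul_conjTranspose K hH)

lemma exists_steinBlockPart_eq_zero_or_posDef [Nonempty (BIdx nn)]
    (K : Matrix (BIdx nn) (BIdx nn) ℂ) :
    (∃ X ∈ densityMatrices (BIdx nn), steinBlockPart K X = 0) ∨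
    ∃ M : ∀ j, Matrix (Fin (nn j)) (Fin (nn j)) ℂ, (∀ j, (M j).IsHermitian) ∧
      IsUnit (blockDiagonal' M) ∧
      (blockDiagonal' M - K * blockDiagonal' M * Kᴴ).PosDef := by
  obtain ⟨X₀, h₀, hmin⟩ := exists_density_minimizer (steinBlockPart K)
  by_cases hz : steinBlockPart K X₀ = 0
  · exact Or.inl ⟨X₀, h₀, hz⟩
  right
  set M₀ := blockDiag' (X₀ - Kᴴ * X₀ * K) with hM₀
  set H₀ := blockDiagonal' M₀ with hH₀
  have hT : steinBlockPart K X₀ = H₀ := rfl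
  rw [hT] at hz hmin
  have hM₀h (j) : (M₀ j).IsHermitian := by
    have hX : (X₀ - Kᴴ * X₀ * K).IsHermitian :=
      h₀.1.isHermitian.sub (isHermitian_conjTranspose_mul_mul K h₀.1.isHermitian)
    change (blockDiag' _ j)ᴴ = _
    rw [← blockDiag'_conjTranspose, hX]
  have hH₀h : H₀ᴴ = H₀ := by
    rw [hH₀, blockDiagonal'_conjTranspose]
    congr 1; funext j; exact hM₀h j
  set q := (H₀ᴴ * H₀).trace.re with hq
  have hq0 : 0 < q := by
    refine lt_of_le_of_ne (re_trace_conjTranspose_mul_self_nonneg _) fun h => hz ?_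
    rw [← trace_conjTranspose_mul_self_eq_zero_iff]
    have h1 := Complex.nonneg_iff.1 (posSemidef_conjTranspose_mul_self H₀).trace_nonneg
    exact Complex.ext h.symm h1.2.symm
  have hlow (v : BIdx nn → ℂ) (hv : v ≠ 0) :
      q * (star v ⬝ᵥ v).re ≤ (star v ⬝ᵥ (H₀ - K * H₀ * Kᴴ) *ᵥ v).re := by
    have hs : 0 < star v ⬝ᵥ v := dotProduct_star_self_pos_iff.2 hv
    obtain ⟨s, hs0, hs1⟩ : ∃ s : ℝ, 0 < s ∧ star v ⬝ᵥ v = s :=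
      ⟨_, (Complex.pos_iff.1 hs).1, Complex.ext rfl (Complex.pos_iff.1 hs).2.symm⟩
    have hmem : ((s⁻¹ : ℝ) : ℂ) • vecMulVec v (star v) ∈ densityMatrices (BIdx nn) := by
      refine ⟨(posSemidef_vecMulVec_self_star v).smul ?_, ?_⟩
      · exact_mod_cast (inv_pos.2 hs0).le
      · rw [trace_smul, trace_vecMulVec, dotProduct_comm, hs1, smul_eq_mul]
        norm_cast
        exact inv_mul_cancel₀ hs0.ne'
    have h1 := hmin _ hmem
    rw [hH₀h, hH₀, trace_blockDiagonal'_mul_steinBlockPart, ← hH₀, Matrix.mul_smul, mul_vecMulVec,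
      trace_smul, trace_vecMulVec, dotProduct_comm, smul_eq_mul, Complex.re_ofReal_mul] at h1
    rw [hs1, Complex.ofReal_re]
    rwa [inv_mul_eq_div, le_div_iff₀ hs0] at h1
  obtain ⟨C, hC0, hC⟩ := exists_re_dotProduct_mul_conjTranspose_le K
  obtain ⟨ε, hε0, hε1, hunit⟩ := exists_pos_lt_isUnit_add_smul_one H₀
    (div_pos hq0 (by linarith : 0 < C + 1))
  rw [lt_div_iff₀ (by linarith)] at hε1
  have hsum : blockDiagonal' (M₀ + (ε : ℂ) • 1) = H₀ + (ε : ℂ) • 1 := by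
    rw [blockDiagonal'_add, blockDiagonal'_smul, blockDiagonal'_one]
  have hherm (j) : ((M₀ + (ε : ℂ) • 1) j).IsHermitian := by
    refine (hM₀h j).add ?_
    change (_)ᴴ = _
    simp
  refine ⟨M₀ + (ε : ℂ) • 1, hherm, hsum ▸ hunit, ?_⟩
  have hbh : (blockDiagonal' (M₀ + (ε : ℂ) • 1)).IsHermitian := by
    change _ᴴ = _
    rw [blockDiagonal'_conjTranspose]
    congr 1; funext j; exact hherm j
  have hdiff := isHermitian_sub_mul_mul_conjTranspose hbh K
  refine PosDef.of_dotProduct_mulVec_pos hdiff fun v hv => ?_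
  refine Complex.pos_iff.2 ⟨?_, (hdiff.im_star_dotProduct_mulVec_self v).symm⟩
  have hs := (Complex.pos_iff.1 (dotProduct_star_self_pos_iff.2 hv)).1
  have h1 := hlow v hv
  have h2 := hC v
  have hexp : star v ⬝ᵥ (blockDiagonal' (M₀ + (ε : ℂ) • 1) -
      K * blockDiagonal' (M₀ + (ε : ℂ) • 1) * Kᴴ) *ᵥ v =
      star v ⬝ᵥ (H₀ - K * H₀ * Kᴴ) *ᵥ v +
        (ε : ℂ) * (star v ⬝ᵥ v - star v ⬝ᵥ (K * Kᴴ) *ᵥ v) := by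
    have : H₀ + (ε : ℂ) • 1 - K * (H₀ + (ε : ℂ) • 1) * Kᴴ =
        H₀ - K * H₀ * Kᴴ + (ε : ℂ) • (1 - K * Kᴴ) := by
      rw [mul_add, add_mul, smul_sub]; simp; abel
    rw [hsum, this, add_mulVec, dotProduct_add, smul_mulVec, dotProduct_smul, sub_mulVec 1,
      dotProduct_sub _ (1 *ᵥ v), one_mulVec, smul_eq_mul]
  rw [hexp, Complex.add_re, Complex.re_ofReal_mul, Complex.sub_re]
  nlinarith [mul_pos hε0 hs, mul_le_mul_of_nonneg_left h2 hε0.le, mul_pos (sub_pos.2 hε1) hs]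

lemma exists_unitary_ncDet_eq_zero (K : Matrix (BIdx nn) (BIdx nn) ℂ) (c : ℂ) {m : ℕ}
    (Y : Matrix (Fin m) (BIdx nn) ℂ) (hY : Y ≠ 0)
    (h : blockDiag' (Yᴴ * Y) = blockDiag' ((Y * K)ᴴ * (Y * K))) :
    ∃ U : ∀ _ : Fin d, Matrix (Fin m) (Fin m) ℂ,
      (∀ j, U j ∈ unitaryGroup (Fin m) ℂ) ∧ ncDet nn K c U = 0 := by
  have hU (j : Fin d) : ∃ U ∈ unitaryGroup (Fin m) ℂ,
      Y.submatrix id (Sigma.mk j) = U * (Y * K).submatrix id (Sigma.mk j) :=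
    exists_unitary_mul_eq _ _ (congrFun h j)
  choose U hU hYU using hU
  refine ⟨fun j => (U j)ᵀ, fun j => transpose_mem_unitaryGroup_iff.2 (hU j), ?_⟩
  rw [ncDet, mul_eq_zero]
  refine Or.inr (exists_vecMul_eq_zero_iff.1 ⟨fun p => Y p.2 p.1, fun h0 => hY ?_, ?_⟩)
  · ext i a
    exact congrFun h0 (a, i)
  · rw [vecMul_sub, vecMul_one, sub_eq_zero, ← vecMul_vecMul]
    have hK : (fun p : BIdx nn × Fin m => Y p.2 p.1) ᵥ* (K ⊗ₖ (1 : Matrix (Fin m) (Fin m) ℂ)) =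
        fun p => (Y * K) p.2 p.1 := by
      funext p
      simp [vecMul, dotProduct, Fintype.sum_prod_type, one_apply, mul_apply]
    rw [hK]
    funext ⟨⟨j, b⟩, i⟩
    have := congrFun (congrFun (hYU j) i) b
    rw [submatrix_apply, mul_apply] at this
    refine this.trans ?_
    simp only [vecMul, dotProduct, Fintype.sum_prod_type, oplusKron]
    rw [Finset.sum_comm]
    simp [mul_comm]

lemma oplusKron_mul_conjTranspose {m : ℕ} {U : ∀ _ : Fin d, Matrix (Fin m) (Fin m) ℂ}
    (hU : ∀ j, U j ∈ unitaryGroup (Fin m) ℂ) : oplusKron nn U * (oplusKron nn U)ᴴ = 1 := by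
  ext ⟨a, i⟩ ⟨b, k⟩
  have h := congrFun (congrFun (mem_unitaryGroup_iff.1 (hU a.1)) i) k
  rw [mul_apply] at h
  simp only [mul_apply, conjTranspose_apply, oplusKron, Fintype.sum_prod_type]
  rw [Finset.sum_comm]
  by_cases hab : a = b
  · subst hab
    simpa [one_apply, star_apply] using h
  · simp [one_apply, hab, Ne.symm hab]

lemma oplusKron_mul_kronecker_blockDiagonal' {m : ℕ} (U : ∀ _ : Fin d, Matrix (Fin m) (Fin m) ℂ)
    (M : ∀ j, Matrix (Fin (nn j)) (Fin (nn j)) ℂ) :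
    oplusKron nn U * (blockDiagonal' M ⊗ₖ 1) = (blockDiagonal' M ⊗ₖ 1) * oplusKron nn U := by
  ext ⟨a, i⟩ ⟨b, k⟩
  have hM : blockDiagonal' M a b * U a.1 i k = blockDiagonal' M a b * U b.1 i k := by
    by_cases h : a.1 = b.1
    · rw [h]
    · rw [blockDiagonal'_apply, dif_neg h, zero_mul, zero_mul]
  simpa [mul_apply, oplusKron, Fintype.sum_prod_type, one_apply, mul_comm] using hM

lemma ncDet_ne_zero_of_posDef (K : Matrix (BIdx nn) (BIdx nn) ℂ) {c : ℂ} (hc : c ≠ 0)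
    (M : ∀ j, Matrix (Fin (nn j)) (Fin (nn j)) ℂ)
    (hM : (blockDiagonal' M - K * blockDiagonal' M * Kᴴ).PosDef) {m : ℕ}
    {U : ∀ _ : Fin d, Matrix (Fin m) (Fin m) ℂ} (hU : ∀ j, U j ∈ unitaryGroup (Fin m) ℂ) :
    ncDet nn K c U ≠ 0 := by
  rw [ncDet]
  refine mul_ne_zero hc fun hdet => ?_
  obtain ⟨v, hv0, hv⟩ := exists_vecMul_eq_zero_iff.2 hdet
  rw [vecMul_sub, vecMul_one, sub_eq_zero] at hv
  set A := (K ⊗ₖ (1 : Matrix (Fin m) (Fin m) ℂ)) * oplusKron nn U with hA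
  set H := blockDiagonal' M with hH
  have hpd := (hM.kronecker (PosDef.one (n := Fin m) (R := ℂ))).dotProduct_mulVec_pos
    (star_ne_zero.2 hv0)
  have hAH : (H - K * H * Kᴴ) ⊗ₖ (1 : Matrix (Fin m) (Fin m) ℂ) =
      H ⊗ₖ 1 - A * (H ⊗ₖ 1) * Aᴴ := by
    have h1 : A * (H ⊗ₖ 1) * Aᴴ = (K ⊗ₖ 1) * (H ⊗ₖ 1) * (K ⊗ₖ 1)ᴴ := by
      have h2 : oplusKron nn U * (H ⊗ₖ 1) * (oplusKron nn U)ᴴ = H ⊗ₖ 1 := by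
        rw [hH, oplusKron_mul_kronecker_blockDiagonal', mul_assoc,
          oplusKron_mul_conjTranspose hU, mul_one]
      conv_rhs => rw [← h2]
      simp only [hA, conjTranspose_mul, mul_assoc]
    rw [h1, conjTranspose_kronecker, ← mul_kronecker_mul, ← mul_kronecker_mul, conjTranspose_one,
      one_mul, one_mul]
    ext
    simp [sub_mul]
  rw [hAH, star_star, sub_mulVec, dotProduct_sub, ← mulVec_mulVec, ← mulVec_mulVec,
    dotProduct_mulVec v A, ← hv, ← star_vecMul, ← hv, sub_self] at hpd
  exact hpd.false

end Blocks

lemma Matrix.IsHermitian.exists_eq_mul_signature_mul_conjTranspose {ι : Type*} [Fintype ι]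
    [DecidableEq ι] {H : Matrix ι ι ℂ} (hH : H.IsHermitian) :
    ∃ (S : Matrix ι ι ℂ) (e : ι → ℂ), (∀ i, e i = 1 ∨ e i = -1) ∧ S * diagonal e * Sᴴ = H := by
  set V : Matrix ι ι ℂ := (hH.eigenvectorUnitary).1
  set l := hH.eigenvalues
  refine ⟨V * diagonal fun i => ((Real.sqrt |l i| : ℝ) : ℂ), fun i => if 0 ≤ l i then 1 else -1,
    fun i => by by_cases h : 0 ≤ l i <;> simp [h], ?_⟩
  have hsp : H = V * diagonal (fun i => (l i : ℂ)) * Vᴴ := by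
    conv_lhs => rw [hH.spectral_theorem, Unitary.conjStarAlgAut_apply]
    rfl
  rw [conjTranspose_mul, diagonal_conjTranspose, hsp]
  simp only [mul_assoc]
  rw [← mul_assoc (diagonal _) (diagonal _) Vᴴ, diagonal_mul_diagonal,
    ← mul_assoc (diagonal _) (diagonal _) Vᴴ, diagonal_mul_diagonal]
  congr 3
  funext i
  have hsq := Real.mul_self_sqrt (abs_nonneg (l i))
  by_cases h : 0 ≤ l i
  · rw [abs_of_nonneg h] at hsq
    simp only [h, if_true, Pi.star_apply, one_mul, abs_of_nonneg h, Complex.star_def,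
      Complex.conj_ofReal]
    exact_mod_cast hsq
  · rw [abs_of_neg (not_le.1 h)] at hsq
    simp only [h, if_false, Pi.star_apply, abs_of_neg (not_le.1 h), Complex.star_def,
      Complex.conj_ofReal]
    rw [neg_one_mul, mul_neg, ← Complex.ofReal_mul, hsq, Complex.ofReal_neg, neg_neg]

section Signature

variable {d : ℕ} {nn : Fin d → ℕ}

lemma conj_sub_conj_mul_mul_conjTranspose {ι : Type*} [Fintype ι] [DecidableEq ι]
    {S : Matrix ι ι ℂ} (hS : IsUnit S) (K J : Matrix ι ι ℂ) :
    S * (J - (S⁻¹ * K * S) * J * (S⁻¹ * K * S)ᴴ) * Sᴴ =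
      S * J * Sᴴ - K * (S * J * Sᴴ) * Kᴴ := by
  have h1 : S * S⁻¹ = 1 := mul_nonsing_inv _ ((isUnit_iff_isUnit_det _).1 hS)
  have h2 : S⁻¹ᴴ * Sᴴ = 1 := by rw [← conjTranspose_mul, h1, conjTranspose_one]
  have h3 : S * ((S⁻¹ * K * S) * J * (S⁻¹ * K * S)ᴴ) * Sᴴ =
      (S * S⁻¹) * K * (S * J * Sᴴ) * Kᴴ * (S⁻¹ᴴ * Sᴴ) := by
    simp only [conjTranspose_mul, mul_assoc]
  rw [mul_sub, sub_mul, h3, h1, h2, one_mul, mul_one]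

lemma structSimStrictContr_of_posDef (K : Matrix (BIdx nn) (BIdx nn) ℂ)
    (M : ∀ j, Matrix (Fin (nn j)) (Fin (nn j)) ℂ) (hMh : ∀ j, (M j).IsHermitian)
    (hu : IsUnit (blockDiagonal' M))
    (hM : (blockDiagonal' M - K * blockDiagonal' M * Kᴴ).PosDef) :
    StructSimStrictContr nn K := by
  choose S e he hS using fun j => (hMh j).exists_eq_mul_signature_mul_conjTranspose
  have hSJ : blockDiagonal' S * diagonal (fun a : BIdx nn => e a.1 a.2) * (blockDiagonal' S)ᴴ =
      blockDiagonal' M := by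
    rw [blockDiagonal'_conjTranspose, ← blockDiagonal'_diagonal, ← blockDiagonal'_mul,
      ← blockDiagonal'_mul]
    congr 1
    funext j
    exact hS j
  have hSu : IsUnit (blockDiagonal' S) := by
    rw [isUnit_iff_isUnit_det] at hu ⊢
    rw [← hSJ, det_mul, det_mul] at hu
    exact isUnit_of_mul_isUnit_left (isUnit_of_mul_isUnit_left hu)
  refine ⟨S, hSu, _, ⟨fun a => e a.1 a.2, fun a => he a.1 a.2, rfl⟩, ?_⟩
  rw [← hSJ, ← conj_sub_conj_mul_mul_conjTranspose hSu] at hM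
  exact (IsUnit.posDef_star_right_conjugate_iff hSu).1 hM

lemma StructSimStrictContr.exists_posDef {K : Matrix (BIdx nn) (BIdx nn) ℂ}
    (h : StructSimStrictContr nn K) : ∃ M : ∀ j, Matrix (Fin (nn j)) (Fin (nn j)) ℂ,
      (blockDiagonal' M - K * blockDiagonal' M * Kᴴ).PosDef := by
  obtain ⟨S, hS, J, ⟨e, -, rfl⟩, hJ⟩ := h
  refine ⟨fun j => S j * diagonal (fun i => e ⟨j, i⟩) * (S j)ᴴ, ?_⟩
  rw [blockDiagonal'_mul, blockDiagonal'_mul, blockDiagonal'_diagonal,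
    ← blockDiagonal'_conjTranspose]
  rw [← conj_sub_conj_mul_mul_conjTranspose hS]
  exact (IsUnit.posDef_star_right_conjugate_iff hS).2 hJ

end Signature

theorem stmt0 {d : ℕ} (nn : Fin d → ℕ) (hnn : ∀ j, 0 < nn j)
    (K : Matrix (BIdx nn) (BIdx nn) ℂ) (c : ℂ) (hc : c ≠ 0) :
    List.TFAE
      [∀ (m : ℕ) (U : ∀ _ : Fin d, Matrix (Fin m) (Fin m) ℂ),
          (∀ j, U j ∈ Matrix.unitaryGroup (Fin m) ℂ) → ncDet nn K c U ≠ 0,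
        ∀ (m : ℕ), 1 ≤ m → m ≤ ∑ j, nn j →
          ∀ U : ∀ _ : Fin d, Matrix (Fin m) (Fin m) ℂ,
          (∀ j, U j ∈ Matrix.unitaryGroup (Fin m) ℂ) → ncDet nn K c U ≠ 0,
        StructSimStrictContr nn K] := by
  tfae_have 1 → 2 := fun h m _ _ U hU => h m U hU
  tfae_have 3 → 1 := fun h m U hU => by
    obtain ⟨M, hM⟩ := h.exists_posDef
    exact ncDet_ne_zero_of_posDef K hc M hM hU
  tfae_have 2 → 3 := fun h => by
    have hcard : Fintype.card (BIdx nn) = ∑ j, nn j := by simp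
    rcases isEmpty_or_nonempty (BIdx nn) with hE | hE
    · exact structSimStrictContr_of_posDef K 0 (fun j => isHermitian_zero)
        (isUnit_of_subsingleton _)
        (PosDef.of_dotProduct_mulVec_pos (Subsingleton.elim _ _)
          fun x hx => (hx (Subsingleton.elim _ _)).elim)
    rcases exists_steinBlockPart_eq_zero_or_posDef K with ⟨X, ⟨hX, htr⟩, hX0⟩ | ⟨M, h1, h2, h3⟩
    · obtain ⟨B, rfl⟩ := hX.exists_eq_conjTranspose_mul_self
      have f : BIdx nn ≃ Fin (∑ j, nn j) := Fintype.equivFinOfCardEq hcard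
      set Y := B.submatrix f.symm id with hYdef
      have hYY : Yᴴ * Y = Bᴴ * B := by
        rw [hYdef, conjTranspose_submatrix, submatrix_mul_equiv, submatrix_id_id]
      have hblock : blockDiag' (Yᴴ * Y) = blockDiag' ((Y * K)ᴴ * (Y * K)) := by
        have h0 : blockDiagonal' (blockDiag' (Bᴴ * B - Kᴴ * (Bᴴ * B) * K)) = blockDiagonal' 0 :=
          hX0.trans blockDiagonal'_zero.symm
        have h1 := blockDiagonal'_injective h0
        rw [blockDiag'_sub, sub_eq_zero] at h1
        rw [hYY, h1, ← hYY, conjTranspose_mul]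
        simp only [Matrix.mul_assoc]
      have hY : Y ≠ 0 := by
        rintro hY0
        rw [← hYY, hY0] at htr
        simp at htr
      obtain ⟨U, hU, hdet⟩ := exists_unitary_ncDet_eq_zero K c Y hY hblock
      refine (h _ ?_ le_rfl U hU hdet).elim
      rw [← hcard]
      exact Fintype.card_pos
    · exact structSimStrictContr_of_posDef K M h1 h2 h3
  tfae_finish
end

section
/- Let K ∈ ℂ^{n×n} with n = n₁+⋯+n_d, let L be positive semidefinite, factored as L = XX* with X ∈ ℂ^{n×m}, write X = col(X₁,…,X_d) with X_j ∈ ℂ^{n_j×m}, and write K*X = col(Y₁,…,Y_d) with Y_j ∈ ℂ^{n_j×m}. Then L ∈ 𝒲_K^⊥ if and only if there exist unitary matrices V₁,…,V_d ∈ ℂ^{m×m} such that Y_j = X_j V_j for j = 1,…,d. -/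
open Matrix Kronecker
open scoped ComplexOrder

/-- The real subspace `𝒲_K = {⊕_j H_j − K (⊕_j H_j) K* : H_j Hermitian}` of `ℋ_n`. -/
def WK {d : ℕ} (nn : Fin d → ℕ) (K : Matrix (BIdx nn) (BIdx nn) ℂ) :
    Set (Matrix (BIdx nn) (BIdx nn) ℂ) :=
  { W | ∃ H : ∀ j : Fin d, Matrix (Fin (nn j)) (Fin (nn j)) ℂ,
      (∀ j, (H j).IsHermitian) ∧
      W = Matrix.blockDiagonal' H - K * Matrix.blockDiagonal' H * Kᴴ }

/-- The orthogonal complement `𝒲_K^⊥` of `𝒲_K` inside the Hermitian matrices `ℋ_n`,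
with respect to the trace inner product `⟨A,B⟩ = Tr(AB)`. -/
def WKperp {d : ℕ} (nn : Fin d → ℕ) (K : Matrix (BIdx nn) (BIdx nn) ℂ) :
    Set (Matrix (BIdx nn) (BIdx nn) ℂ) :=
  { L | L.IsHermitian ∧ ∀ W ∈ WK nn K, Matrix.trace (L * W) = 0 }

/-- The `j`-th block `X_j ∈ ℂ^{n_j × m}` of `X = col(X₁,…,X_d) ∈ ℂ^{n × m}`. -/
def blk {d : ℕ} (nn : Fin d → ℕ) {m : ℕ} (X : Matrix (BIdx nn) (Fin m) ℂ)
    (j : Fin d) : Matrix (Fin (nn j)) (Fin m) ℂ :=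
  fun a k => X ⟨j, a⟩ k

/-- Two matrices with the same Gram matrix `A * Aᴴ` differ by a unitary factor on the right. -/
theorem exists_unitary_eq_mul_of_mul_conjTranspose_eq {p m : Type*} [Fintype p] [DecidableEq p]
    [Fintype m] [DecidableEq m] {A B : Matrix p m ℂ} (h : A * Aᴴ = B * Bᴴ) :
    ∃ V ∈ Matrix.unitaryGroup m ℂ, B = A * V := by
  set f := toEuclideanLin Aᴴ with hf
  set g := toEuclideanLin Bᴴ with hg
  have hadj : f.adjoint ∘ₗ f = g.adjoint ∘ₗ g := by
    rw [hf, hg, ← toEuclideanLin_conjTranspose_eq_adjoint,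
      ← toEuclideanLin_conjTranspose_eq_adjoint, conjTranspose_conjTranspose,
      conjTranspose_conjTranspose]
    ext x : 1
    simpa [toLpLin_apply] using congrArg (fun M => M *ᵥ (x : p → ℂ)) h
  have hnorm (x) : ‖g x‖ = ‖f x‖ := by
    have hinner : inner ℂ (g x) (g x) = inner ℂ (f x) (f x) := by
      rw [← LinearMap.adjoint_inner_right, ← LinearMap.adjoint_inner_right]
      exact congrArg (inner ℂ x) (LinearMap.congr_fun hadj x).symm
    rw [@norm_eq_sqrt_re_inner ℂ, @norm_eq_sqrt_re_inner ℂ, hinner]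
  obtain ⟨s, hs⟩ := f.rangeRestrict.exists_rightInverse_of_surjective f.range_rangeRestrict
  have hfs (y : LinearMap.range f) : f (s y) = y :=
    congrArg Subtype.val (LinearMap.congr_fun hs y)
  let U : EuclideanSpace ℂ m →ₗᵢ[ℂ] EuclideanSpace ℂ m :=
    LinearIsometry.extend (S := LinearMap.range f)
      { toLinearMap := g ∘ₗ s
        norm_map' := fun y => by
          rw [LinearMap.comp_apply, hnorm, hfs, Submodule.coe_norm] }
  have hU : U.toLinearMap ∘ₗ f = g := by
    ext1 x
    have hx : U (f x) = g (s (f.rangeRestrict x)) :=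
      LinearIsometry.extend_apply _ (f.rangeRestrict x)
    rw [LinearMap.comp_apply, LinearIsometry.coe_toLinearMap, hx, ← sub_eq_zero, ← map_sub,
      ← norm_eq_zero, hnorm, map_sub, hfs, LinearMap.codRestrict_apply, sub_self, norm_zero]
  obtain ⟨W, hW⟩ := (toEuclideanLin (𝕜 := ℂ) (m := m) (n := m)).surjective U.toLinearMap
  have hWW : Wᴴ * W = 1 := by
    apply (toEuclideanLin (𝕜 := ℂ) (m := m) (n := m)).injective
    rw [toLpLin_mul_same, toEuclideanLin_conjTranspose_eq_adjoint, hW, toLpLin_one]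
    ext1 x
    refine ext_inner_left ℂ fun y => ?_
    simp
  have hWA : W * Aᴴ = Bᴴ := by
    apply toEuclideanLin.injective
    rw [toLpLin_mul_same, hW]
    exact hU
  refine ⟨Wᴴ, ?_, ?_⟩
  · rw [Matrix.mem_unitaryGroup_iff, star_eq_conjTranspose, conjTranspose_conjTranspose, hWW]
  · simpa using (congrArg conjTranspose hWA).symm

theorem trace_mul_blockDiagonal' {ι R : Type*} [Fintype ι] [DecidableEq ι] {p : ι → Type*}
    [∀ i, Fintype (p i)] [NonUnitalNonAssocSemiring R]
    (M : Matrix (Σ i, p i) (Σ i, p i) R) (H : ∀ i, Matrix (p i) (p i) R) :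
    trace (M * blockDiagonal' H) = ∑ i, trace (blockDiag' M i * H i) := by
  simp only [trace, diag_apply, mul_apply, Fintype.sum_sigma]
  refine Finset.sum_congr rfl fun i _ => Finset.sum_congr rfl fun a _ => ?_
  rw [Finset.sum_eq_single i]
  · simp [blockDiag'_apply]
  · intro k _ hk
    simp [blockDiagonal'_apply_ne _ _ _ hk]
  · simp

theorem blockDiag'_mul_conjTranspose_eq_blk {d : ℕ} (nn : Fin d → ℕ) {m : ℕ}
    (X : Matrix (BIdx nn) (Fin m) ℂ) (j : Fin d) :
    blockDiag' (X * Xᴴ) j = blk nn X j * (blk nn X j)ᴴ := by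
  ext a b
  simp [blockDiag'_apply, mul_apply, blk]

theorem trace_mul_conjTranspose_mul_sub {d : ℕ} (nn : Fin d → ℕ)
    (K : Matrix (BIdx nn) (BIdx nn) ℂ) {m : ℕ} (X : Matrix (BIdx nn) (Fin m) ℂ)
    (H : ∀ j : Fin d, Matrix (Fin (nn j)) (Fin (nn j)) ℂ) :
    trace (X * Xᴴ * (blockDiagonal' H - K * blockDiagonal' H * Kᴴ)) =
      ∑ j, trace ((blk nn X j * (blk nn X j)ᴴ -
        blk nn (Kᴴ * X) j * (blk nn (Kᴴ * X) j)ᴴ) * H j) := by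
  have hK : trace (X * Xᴴ * (K * blockDiagonal' H * Kᴴ)) =
      trace ((Kᴴ * X) * (Kᴴ * X)ᴴ * blockDiagonal' H) := by
    rw [← Matrix.mul_assoc, trace_mul_comm]
    simp only [conjTranspose_mul, conjTranspose_conjTranspose, Matrix.mul_assoc]
  rw [Matrix.mul_sub, trace_sub, hK, trace_mul_blockDiagonal', trace_mul_blockDiagonal',
    ← Finset.sum_sub_distrib]
  simp only [blockDiag'_mul_conjTranspose_eq_blk, Matrix.sub_mul, trace_sub]

/-- `X * Xᴴ` lies in `𝒲_K^⊥` iff the blocks of `X` and of `Kᴴ * X` have equal Gram matrices. -/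
theorem mul_conjTranspose_mem_WKperp_iff {d : ℕ} (nn : Fin d → ℕ)
    (K : Matrix (BIdx nn) (BIdx nn) ℂ) {m : ℕ} (X : Matrix (BIdx nn) (Fin m) ℂ) :
    X * Xᴴ ∈ WKperp nn K ↔ ∀ j, blk nn X j * (blk nn X j)ᴴ =
      blk nn (Kᴴ * X) j * (blk nn (Kᴴ * X) j)ᴴ := by
  constructor
  · rintro ⟨-, h⟩
    set D := fun j => blk nn X j * (blk nn X j)ᴴ - blk nn (Kᴴ * X) j * (blk nn (Kᴴ * X) j)ᴴ
      with hD
    have hherm (j) : (D j).IsHermitian :=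
      (isHermitian_mul_conjTranspose_self _).sub (isHermitian_mul_conjTranspose_self _)
    have hsum := h _ ⟨D, hherm, rfl⟩
    rw [trace_mul_conjTranspose_mul_sub] at hsum
    have hsq (j) : D j * D j = (D j)ᴴ * D j := by rw [(hherm j).eq]
    have hnonneg (j) : 0 ≤ trace (D j * D j) := by
      rw [hsq]
      exact (posSemidef_conjTranspose_mul_self _).trace_nonneg
    intro j
    have hj := (Finset.sum_eq_zero_iff_of_nonneg fun j _ => hnonneg j).1 hsum j (Finset.mem_univ j)
    rw [hsq, trace_conjTranspose_mul_self_eq_zero_iff] at hj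
    exact sub_eq_zero.1 hj
  · refine fun h => ⟨isHermitian_mul_conjTranspose_self _, ?_⟩
    rintro _ ⟨H, -, rfl⟩
    rw [trace_mul_conjTranspose_mul_sub]
    simp [h]

theorem stmt5 {d : ℕ} (nn : Fin d → ℕ) (hnn : ∀ j, 0 < nn j)
    (K : Matrix (BIdx nn) (BIdx nn) ℂ) {m : ℕ}
    (X : Matrix (BIdx nn) (Fin m) ℂ)
    (L : Matrix (BIdx nn) (BIdx nn) ℂ) (hL : L = X * Xᴴ) :
    L ∈ WKperp nn K ↔
      ∃ V : ∀ _ : Fin d, Matrix (Fin m) (Fin m) ℂ,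
        (∀ j, V j ∈ Matrix.unitaryGroup (Fin m) ℂ) ∧
        ∀ j, blk nn (Kᴴ * X) j = blk nn X j * V j := by
  subst hL
  rw [mul_conjTranspose_mem_WKperp_iff]
  constructor
  · intro h
    choose V hV hXV using fun j => exists_unitary_eq_mul_of_mul_conjTranspose_eq (h j)
    exact ⟨V, hV, hXV⟩
  · rintro ⟨V, hV, hXV⟩ j
    have hVV : V j * (V j)ᴴ = 1 := Matrix.mem_unitaryGroup_iff.1 (hV j)
    rw [hXV, conjTranspose_mul, Matrix.mul_assoc, ← Matrix.mul_assoc (V j), hVV, Matrix.one_mul]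
end

section
/- Let K ∈ ℂ^{n×n} with n = n₁+⋯+n_d. The following are equivalent: (i) there exists an invertible block diagonal matrix S = ⊕_{j=1}^d S_j with S_j ∈ ℂ^{n_j×n_j} such that S⁻¹KS is a strict J-contraction for some diagonal signature matrix J; (ii) 𝒲_K contains a positive definite matrix; (iii) the only positive semidefinite matrix in 𝒲_K^⊥ is 0. -/
open Matrix Kronecker
open scoped ComplexOrder

namespace Matrix

variable {ι : Type*} [Fintype ι] [DecidableEq ι]

theorem IsHermitian.eq_mul_diagonal_mul {A : Matrix ι ι ℂ} (hA : A.IsHermitian) :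
    A = (hA.eigenvectorUnitary : Matrix ι ι ℂ) * diagonal (fun i => (hA.eigenvalues i : ℂ)) *
      (hA.eigenvectorUnitary : Matrix ι ι ℂ)ᴴ := by
  conv_lhs => rw [hA.spectral_theorem]
  simp [Unitary.conjStarAlgAut_apply, star_eq_conjTranspose, Function.comp_def]

theorem IsHermitian.exists_add_smul_one_posSemidef {A : Matrix ι ι ℂ} (hA : A.IsHermitian) :
    ∃ c : ℝ, (A + c • (1 : Matrix ι ι ℂ)).PosSemidef := by
  refine ⟨∑ i, |hA.eigenvalues i|, ?_⟩
  set c := ∑ i, |hA.eigenvalues i|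
  have hU : (hA.eigenvectorUnitary : Matrix ι ι ℂ) * (hA.eigenvectorUnitary : Matrix ι ι ℂ)ᴴ = 1 :=
    Unitary.coe_mul_star_self _
  have h : A + c • (1 : Matrix ι ι ℂ) =
      (hA.eigenvectorUnitary : Matrix ι ι ℂ) *
        diagonal (fun i => ((hA.eigenvalues i + c : ℝ) : ℂ)) *
        (hA.eigenvectorUnitary : Matrix ι ι ℂ)ᴴ := by
    have hd : diagonal (fun i => ((hA.eigenvalues i + c : ℝ) : ℂ)) =
        diagonal (fun i => (hA.eigenvalues i : ℂ)) + c • (1 : Matrix ι ι ℂ) := by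
      ext i j
      rcases eq_or_ne i j with rfl | h <;> simp [*]
    rw [hd, mul_add, add_mul, ← hA.eq_mul_diagonal_mul, mul_smul_comm, smul_mul_assoc, mul_one, hU]
  rw [h]
  refine PosSemidef.mul_mul_conjTranspose_same (posSemidef_diagonal_iff.2 fun i => ?_) _
  have h1 : |hA.eigenvalues i| ≤ c :=
    Finset.single_le_sum (f := fun i => |hA.eigenvalues i|) (fun _ _ => abs_nonneg _)
      (Finset.mem_univ i)
  exact_mod_cast (by linarith [neg_abs_le (hA.eigenvalues i)] : 0 ≤ hA.eigenvalues i + c)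

theorem PosSemidef.eq_zero_of_trace_mul_posDef {L W : Matrix ι ι ℂ} (hL : L.PosSemidef)
    (hW : W.PosDef) (h : (L * W).trace = 0) : L = 0 := by
  obtain ⟨B, rfl⟩ : ∃ B : Matrix ι ι ℂ, L = Bᴴ * B := by
    open MatrixOrder in
    exact CStarAlgebra.nonneg_iff_eq_star_mul_self.1 hL.nonneg
  have h0 : B * W * Bᴴ = 0 := by
    rw [← (hW.posSemidef.mul_mul_conjTranspose_same B).trace_eq_zero_iff, trace_mul_comm,
      ← mul_assoc, h]
  have hB : Bᴴ = 0 := by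
    refine ext_of_mulVec_single fun i => ?_
    rw [zero_mulVec]
    by_contra hy
    have := hW.dotProduct_mulVec_pos hy
    rw [star_mulVec, conjTranspose_conjTranspose, ← dotProduct_mulVec, mulVec_mulVec,
      mulVec_mulVec, h0] at this
    simp at this
  rw [hB, zero_mul]

theorem star_dotProduct_conj_diagonal_mulVec (M : Matrix ι ι ℂ) (l : ι → ℝ) (x : ι → ℂ) :
    star x ⬝ᵥ ((M * diagonal (fun i => (l i : ℂ)) * Mᴴ) *ᵥ x) =
      ((∑ i, l i * ‖(Mᴴ *ᵥ x) i‖ ^ 2 : ℝ) : ℂ) := by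
  have h : star x ⬝ᵥ ((M * diagonal (fun i => (l i : ℂ)) * Mᴴ) *ᵥ x) =
      star (Mᴴ *ᵥ x) ⬝ᵥ (diagonal (fun i => (l i : ℂ)) *ᵥ (Mᴴ *ᵥ x)) := by
    rw [star_mulVec, conjTranspose_conjTranspose, ← dotProduct_mulVec, mulVec_mulVec,
      mulVec_mulVec, mul_assoc]
  rw [h, dotProduct]
  push_cast
  refine Finset.sum_congr rfl fun i _ => ?_
  rw [mulVec_diagonal, Pi.star_apply, ← Complex.conj_mul']
  simp only [starRingEnd_apply]
  ring

theorem ne_zero_of_posDef_stein {U K : Matrix ι ι ℂ} {l : ι → ℝ}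
    (h : (U * diagonal (fun i => (l i : ℂ)) * Uᴴ -
      K * (U * diagonal (fun i => (l i : ℂ)) * Uᴴ) * Kᴴ).PosDef) (i : ι) : l i ≠ 0 := by
  intro hi
  let T : Matrix ι ι ℂ := of fun k => if 0 < l k then Uᴴ k else if l k < 0 then (K * U)ᴴ k else 0
  have hT : T.det = 0 := det_eq_zero_of_row_eq_zero i fun j => by simp [T, hi]
  obtain ⟨x, hx, hTx⟩ := exists_mulVec_eq_zero_iff.2 hT
  have hpos := h.dotProduct_mulVec_pos hx
  have hK : K * (U * diagonal (fun i => (l i : ℂ)) * Uᴴ) * Kᴴ =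
      (K * U) * diagonal (fun i => (l i : ℂ)) * (K * U)ᴴ := by
    simp only [conjTranspose_mul, mul_assoc]
  rw [hK, sub_mulVec, dotProduct_sub, star_dotProduct_conj_diagonal_mulVec,
    star_dotProduct_conj_diagonal_mulVec] at hpos
  norm_cast at hpos
  have h1 : ∑ k, l k * ‖(Uᴴ *ᵥ x) k‖ ^ 2 ≤ 0 := Finset.sum_nonpos fun k _ => by
    rcases lt_or_ge 0 (l k) with hk | hk
    · have : (Uᴴ *ᵥ x) k = 0 := by simpa [T, mulVec, hk] using congrFun hTx k
      simp [this]
    · exact mul_nonpos_of_nonpos_of_nonneg hk (by positivity)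
  have h2 : 0 ≤ ∑ k, l k * ‖((K * U)ᴴ *ᵥ x) k‖ ^ 2 := Finset.sum_nonneg fun k _ => by
    rcases lt_or_ge (l k) 0 with hk | hk
    · have : ((K * U)ᴴ *ᵥ x) k = 0 := by
        simpa only [T, mulVec, of_apply, hk, hk.not_gt, if_true, if_false,
          Pi.zero_apply] using congrFun hTx k
      rw [this]; simp
    · positivity
  linarith

theorem conj_sub_stein {B K J : Matrix ι ι ℂ} (hB : IsUnit B) :
    B * (J - (B⁻¹ * K * B) * J * (B⁻¹ * K * B)ᴴ) * star B =
      B * J * Bᴴ - K * (B * J * Bᴴ) * Kᴴ := by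
  have hdet := (isUnit_iff_isUnit_det _).1 hB
  have h : B * (B⁻¹ * K * B) = K * B := by
    rw [mul_assoc, mul_nonsing_inv_cancel_left _ _ hdet]
  calc _ = B * J * Bᴴ - (B * (B⁻¹ * K * B)) * J * (B * (B⁻¹ * K * B))ᴴ := by
        rw [conjTranspose_mul B, star_eq_conjTranspose, mul_sub, sub_mul]
        simp only [mul_assoc]
    _ = _ := by
        rw [h, conjTranspose_mul]
        simp only [mul_assoc]

/-- The trace pairing represents every complex linear functional on square matrices. -/
theorem exists_trace_mul_eq (F : Matrix ι ι ℂ →ₗ[ℂ] ℂ) :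
    ∃ L : Matrix ι ι ℂ, ∀ A, F A = (L * A).trace := by
  refine ⟨of fun i j => F (single j i 1), fun A => ?_⟩
  conv_lhs => rw [matrix_eq_sum_single A]
  simp only [map_sum, trace, diag, mul_apply, of_apply]
  rw [Finset.sum_comm]
  refine Finset.sum_congr rfl fun i _ => Finset.sum_congr rfl fun j _ => ?_
  rw [show single j i (A j i) = A j i • single j i (1 : ℂ) by simp [smul_single], map_smul,
    smul_eq_mul, mul_comm]

/-- Matrices with positive semidefinite Hermitian part. -/
def accretiveCone (ι : Type*) [Fintype ι] : PointedCone ℝ (Matrix ι ι ℂ) where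
  carrier := {A | (A + Aᴴ).PosSemidef}
  add_mem' {A B} hA hB := by
    have := PosSemidef.add hA hB
    rwa [add_add_add_comm, ← conjTranspose_add] at this
  zero_mem' := by simpa using PosSemidef.zero
  smul_mem' c A hA := by
    have := PosSemidef.smul hA c.2
    rw [smul_add] at this
    have h2 : (c • A)ᴴ = c.1 • Aᴴ := by
      exact (conjTranspose_smul c.1 A).trans (by rw [star_trivial])
    show (c • A + (c • A)ᴴ).PosSemidef
    rw [h2]; exact this

omit [DecidableEq ι] in
theorem mem_accretiveCone {A : Matrix ι ι ℂ} :
    A ∈ accretiveCone ι ↔ (A + Aᴴ).PosSemidef := Iff.rfl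

/-- A positive real functional on the accretive cone is given by a positive semidefinite matrix. -/
theorem exists_posSemidef_trace_mul_eq (g : Matrix ι ι ℂ →ₗ[ℝ] ℝ)
    (hg : ∀ A ∈ accretiveCone ι, 0 ≤ g A) :
    ∃ L : Matrix ι ι ℂ, L.PosSemidef ∧
      ∀ A : Matrix ι ι ℂ, A.IsHermitian → (L * A).trace = (g A : ℂ) := by
  have hskew (A : Matrix ι ι ℂ) (hA : Aᴴ = -A) : g A = 0 := by
    refine le_antisymm ?_ (hg _ ?_)
    · have := hg (-A) (by simp [mem_accretiveCone, hA, PosSemidef.zero])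
      simpa using this
    · simp [mem_accretiveCone, hA, PosSemidef.zero]
  obtain ⟨L, hL⟩ := exists_trace_mul_eq (Module.Dual.extendRCLike (𝕜 := ℂ) g)
  have hLH (A : Matrix ι ι ℂ) (hA : A.IsHermitian) : (L * A).trace = (g A : ℂ) := by
    have := hskew (Complex.I • A) (by simp [hA.eq])
    rw [← hL, Module.Dual.extendRCLike_apply]
    simp [this]
  have hquad (x : ι → ℂ) : star x ⬝ᵥ (L *ᵥ x) = (L * vecMulVec x (star x)).trace := by
    rw [mul_vecMulVec, trace_vecMulVec, dotProduct_comm]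
  have hvec (x : ι → ℂ) : (vecMulVec x (star x)).PosSemidef := posSemidef_vecMulVec_self_star x
  refine ⟨L, ?_, hLH⟩
  have hq (x : ι → ℂ) : 0 ≤ star x ⬝ᵥ (L *ᵥ x) := by
    rw [hquad, hLH _ (hvec x).isHermitian]
    have := hg (vecMulVec x (star x)) (by
      rw [mem_accretiveCone, (hvec x).isHermitian.eq]
      exact (hvec x).add (hvec x))
    exact_mod_cast this
  have hM (A : Matrix ι ι ℂ) (hA : A.IsHermitian) : ((L - Lᴴ) * A).trace = 0 := by
    have h1 : (Lᴴ * A).trace = star (L * A).trace := by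
      rw [← trace_conjTranspose, conjTranspose_mul, hA.eq, trace_mul_comm]
    rw [sub_mul, trace_sub, h1, hLH A hA]
    simp
  have h0 : L - Lᴴ = 0 := by
    rw [← trace_mul_conjTranspose_self_eq_zero_iff]
    have h2 := hM (Complex.I • (L - Lᴴ)) (by
      rw [IsHermitian, conjTranspose_smul, conjTranspose_sub, conjTranspose_conjTranspose]
      simp [smul_sub, neg_add_eq_sub])
    have h3 : (L - Lᴴ)ᴴ = -(L - Lᴴ) := by simp
    rw [h3, mul_neg, trace_neg, neg_eq_zero]
    simpa using h2
  exact .of_dotProduct_mulVec_nonneg (sub_eq_zero.1 h0).symm hq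

theorem exists_posSemidef_orthogonal {W : Submodule ℝ (Matrix ι ι ℂ)}
    (hW : ∀ A ∈ W, A.IsHermitian) (hpos : ∀ A ∈ W, ¬ A.PosDef) :
    ∃ L : Matrix ι ι ℂ, L.PosSemidef ∧ L ≠ 0 ∧ ∀ A ∈ W, (L * A).trace = 0 := by
  have h1 : (1 : Matrix ι ι ℂ) ∉ W := fun h => hpos _ h PosDef.one
  let f₀ : Matrix ι ι ℂ →ₗ.[ℝ] ℝ := ⟨W, 0⟩
  let f := f₀.supSpanSingleton 1 1 h1
  obtain ⟨g, hgf, hg⟩ := riesz_extension (accretiveCone ι) f (by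
    rintro ⟨x, hx⟩ hxs
    obtain ⟨w, hw, z, hz, rfl⟩ := Submodule.mem_sup.1 hx
    obtain ⟨c, rfl⟩ := Submodule.mem_span_singleton.1 hz
    have : f ⟨w + c • 1, hx⟩ = c := by
      have := f₀.supSpanSingleton_apply_mk 1 1 h1 w hw c
      rw [this]; simp [f₀]
    rw [this]
    by_contra! hc
    refine hpos w hw ?_
    have h2 : (w + c • (1 : Matrix ι ι ℂ)).IsHermitian := by
      have := hW w hw
      unfold IsHermitian at *
      simp [this]
    have h3 := mem_accretiveCone.1 hxs
    simp only [h2.eq] at h3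
    have h4 := h3.smul (show (0:ℝ) ≤ 1/2 by norm_num)
    have h5 := PosDef.posSemidef_add h4 (PosDef.one.smul (show 0 < -c by linarith))
    convert h5 using 1
    module) (by
    intro y
    obtain ⟨c, hc⟩ := (isHermitian_add_transpose_self y).exists_add_smul_one_posSemidef
    refine ⟨⟨(c/2) • 1, ?_⟩, ?_⟩
    · exact Submodule.mem_sup_right (Submodule.smul_mem _ _ (Submodule.mem_span_singleton_self _))
    · rw [mem_accretiveCone]
      convert hc using 1
      simp
      module)
  obtain ⟨L, hL, hLg⟩ := exists_posSemidef_trace_mul_eq g hg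
  refine ⟨L, hL, ?_, fun A hA => ?_⟩
  · rintro rfl
    have := hLg 1 isHermitian_one
    have h2 := hgf ⟨1, Submodule.mem_sup_right (Submodule.mem_span_singleton_self _)⟩
    rw [f₀.supSpanSingleton_apply_self] at h2
    simp [h2] at this
  · have h2 := hgf ⟨A, Submodule.mem_sup_left hA⟩
    rw [f₀.supSpanSingleton_apply_mk_of_mem 1 h1 hA] at h2
    simp only [f₀] at h2
    rw [hLg A (hW A hA)]
    simpa using h2

end Matrix

theorem exists_posDef_mem_WK_of_structSim {d : ℕ} {nn : Fin d → ℕ}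
    {K : Matrix (BIdx nn) (BIdx nn) ℂ} (h : StructSimStrictContr nn K) :
    ∃ W ∈ WK nn K, W.PosDef := by
  obtain ⟨S, hS, J, ⟨e, he, rfl⟩, hJ⟩ := h
  refine ⟨_, ⟨fun j => S j * diagonal (fun i => e ⟨j, i⟩) * (S j)ᴴ, fun j => ?_, rfl⟩, ?_⟩
  · have hd : (diagonal fun i => e ⟨j, i⟩)ᴴ = (diagonal fun i => e ⟨j, i⟩) := by
      rw [diagonal_conjTranspose]
      congr 1
      ext i
      rcases he ⟨j, i⟩ with h | h <;> simp [h]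
    simp [IsHermitian, conjTranspose_mul, hd, mul_assoc]
  · have hH : blockDiagonal' (fun j => S j * diagonal (fun i => e ⟨j, i⟩) * (S j)ᴴ) =
        blockDiagonal' S * diagonal e * (blockDiagonal' S)ᴴ := by
      rw [blockDiagonal'_conjTranspose, blockDiagonal'_mul, blockDiagonal'_mul,
        blockDiagonal'_diagonal]
    rw [hH]
    have := hS.posDef_star_right_conjugate_iff.2 hJ
    rwa [conj_sub_stein hS] at this

theorem structSim_of_posDef_mem_WK {d : ℕ} {nn : Fin d → ℕ}
    {K W : Matrix (BIdx nn) (BIdx nn) ℂ} (hW : W ∈ WK nn K) (hpos : W.PosDef) :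
    StructSimStrictContr nn K := by
  obtain ⟨H, hH, rfl⟩ := hW
  let U : ∀ j, Matrix (Fin (nn j)) (Fin (nn j)) ℂ := fun j => (hH j).eigenvectorUnitary
  let l : BIdx nn → ℝ := fun p => (hH p.1).eigenvalues p.2
  have hHU : blockDiagonal' H =
      blockDiagonal' U * diagonal (fun p => (l p : ℂ)) * (blockDiagonal' U)ᴴ := by
    rw [← blockDiagonal'_diagonal (fun j i => (l ⟨j, i⟩ : ℂ)), blockDiagonal'_conjTranspose,
      ← blockDiagonal'_mul, ← blockDiagonal'_mul]
    exact congrArg _ (funext fun j => (hH j).eq_mul_diagonal_mul)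
  have hl : ∀ p, l p ≠ 0 := fun p => by
    rw [hHU] at hpos
    exact ne_zero_of_posDef_stein hpos p
  let r : BIdx nn → ℂ := fun p => (√|l p| : ℝ)
  let s : BIdx nn → ℂ := fun p => if 0 < l p then 1 else -1
  have hS : blockDiagonal' (fun j => U j * diagonal (fun i => r ⟨j, i⟩)) =
      blockDiagonal' U * diagonal r := by
    rw [blockDiagonal'_mul, blockDiagonal'_diagonal]
  have hSJ : blockDiagonal' H = (blockDiagonal' U * diagonal r) * diagonal s *
      (blockDiagonal' U * diagonal r)ᴴ := by
    rw [hHU, conjTranspose_mul, diagonal_conjTranspose]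
    have hd : diagonal (fun p => (l p : ℂ)) = diagonal r * (diagonal s * diagonal (star r)) := by
      rw [diagonal_mul_diagonal, diagonal_mul_diagonal]
      refine congrArg _ (funext fun p => ?_)
      have hr : r p * r p = (|l p| : ℝ) := by
        simp only [r]
        exact_mod_cast Real.mul_self_sqrt (abs_nonneg (l p))
      have hrs : star r p = r p := by simp [r]
      rw [hrs, mul_left_comm, hr]
      rcases (hl p).lt_or_gt with h | h
      · simp [s, h.not_gt, abs_of_neg h]
      · simp [s, h, abs_of_pos h]
    rw [hd]
    simp only [mul_assoc]
  have hunit : IsUnit (blockDiagonal' U * diagonal r) := by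
    refine IsUnit.mul ?_ ?_
    · have hUU : blockDiagonal' U * blockDiagonal' (fun j => (U j)ᴴ) = 1 := by
        rw [← blockDiagonal'_mul, ← blockDiagonal'_one]
        exact congrArg _ (funext fun j => Unitary.coe_mul_star_self _)
      exact IsUnit.of_mul_eq_one _ hUU
    · rw [isUnit_diagonal, Pi.isUnit_iff]
      intro p
      simp [r, hl p]
  refine ⟨fun j => U j * diagonal (fun i => r ⟨j, i⟩), by rwa [hS], diagonal s,
    ⟨s, fun p => by simp only [s]; split_ifs <;> simp, rfl⟩, ?_⟩
  rw [hS]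
  rwa [hSJ, ← conj_sub_stein hunit, hunit.posDef_star_right_conjugate_iff] at hpos

/-- `WK` as a real subspace. -/
def WKSubmodule {d : ℕ} (nn : Fin d → ℕ) (K : Matrix (BIdx nn) (BIdx nn) ℂ) :
    Submodule ℝ (Matrix (BIdx nn) (BIdx nn) ℂ) where
  carrier := WK nn K
  add_mem' := by
    rintro _ _ ⟨H, hH, rfl⟩ ⟨G, hG, rfl⟩
    refine ⟨H + G, fun j => (hH j).add (hG j), ?_⟩
    rw [blockDiagonal'_add, mul_add, add_mul]
    abel
  zero_mem' := ⟨0, fun _ => isHermitian_zero, by simp⟩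
  smul_mem' := by
    rintro c _ ⟨H, hH, rfl⟩
    refine ⟨c • H, fun j => by simp [IsHermitian, (hH j).eq], ?_⟩
    rw [blockDiagonal'_smul, mul_smul_comm, smul_mul_assoc, smul_sub]

theorem isHermitian_of_mem_WK {d : ℕ} {nn : Fin d → ℕ} {K W : Matrix (BIdx nn) (BIdx nn) ℂ}
    (hW : W ∈ WK nn K) : W.IsHermitian := by
  obtain ⟨H, hH, rfl⟩ := hW
  have hB : (blockDiagonal' H).IsHermitian := by
    rw [IsHermitian, blockDiagonal'_conjTranspose]
    exact congrArg _ (funext fun j => (hH j).eq)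
  exact hB.sub (isHermitian_mul_mul_conjTranspose _ hB)

theorem stmt7 {d : ℕ} (nn : Fin d → ℕ) (hnn : ∀ j, 0 < nn j)
    (K : Matrix (BIdx nn) (BIdx nn) ℂ) :
    List.TFAE
      [StructSimStrictContr nn K,
        ∃ W ∈ WK nn K, W.PosDef,
        ∀ L ∈ WKperp nn K, L.PosSemidef → L = 0] := by
  tfae_have 1 → 2 := exists_posDef_mem_WK_of_structSim
  tfae_have 2 → 1 := fun ⟨_, hW, hpos⟩ => structSim_of_posDef_mem_WK hW hpos
  tfae_have 2 → 3 := fun ⟨W, hW, hpos⟩ L hL hLpos =>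
    hLpos.eq_zero_of_trace_mul_posDef hpos (hL.2 W hW)
  tfae_have 3 → 2 := fun h => by
    by_contra! hno
    obtain ⟨L, hL, hL0, hLW⟩ := exists_posSemidef_orthogonal (W := WKSubmodule nn K)
      (fun _ => isHermitian_of_mem_WK) hno
    exact hL0 (h L ⟨hL.isHermitian, hLW⟩ hL)
  tfae_finish
end

section
/- Let K ∈ ℂ^{n×n} with n = n₁+⋯+n_d. There exists an invertible block diagonal matrix S = ⊕_{j=1}^d S_j with S_j ∈ ℂ^{n_j×n_j} such that S⁻¹KS is a strict J-contraction for some diagonal signature matrix J if and only if 𝒲_K contains a positive definite matrix. -/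
open Matrix Kronecker
open scoped ComplexOrder

/-- If `S` intertwines `M` and `K`, then `J ↦ S J Sᴴ` transports the Stein inequality for `M`
to the Stein inequality for `K`. -/
theorem posDef_stein_congr {ι : Type*} [Fintype ι] [DecidableEq ι] {S M K : Matrix ι ι ℂ}
    (J : Matrix ι ι ℂ) (hS : IsUnit S) (h : S * M = K * S) :
    (S * J * Sᴴ - K * (S * J * Sᴴ) * Kᴴ).PosDef ↔ (J - M * J * Mᴴ).PosDef := by
  rw [← hS.posDef_star_right_conjugate_iff (x := J - M * J * Mᴴ)]
  have h' : Mᴴ * Sᴴ = Sᴴ * Kᴴ := by rw [← conjTranspose_mul, h, conjTranspose_mul]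
  have : S * (J - M * J * Mᴴ) * star S = S * J * Sᴴ - K * (S * J * Sᴴ) * Kᴴ := by
    calc S * (J - M * J * Mᴴ) * star S = S * J * Sᴴ - (S * M) * J * (Mᴴ * Sᴴ) := by
          rw [star_eq_conjTranspose]; noncomm_ring
      _ = _ := by rw [h, h']; noncomm_ring
  rw [this]

theorem mul_nonsing_inv_mul_mul {ι : Type*} [Fintype ι] [DecidableEq ι] {S : Matrix ι ι ℂ}
    (K : Matrix ι ι ℂ) (hS : IsUnit S) : S * (S⁻¹ * K * S) = K * S := by
  rw [mul_assoc, mul_nonsing_inv_cancel_left _ _ ((isUnit_iff_isUnit_det S).1 hS)]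

theorem isUnit_blockDiagonal' {o R : Type*} {m : o → Type*} [Fintype o] [DecidableEq o]
    [∀ i, Fintype (m i)] [∀ i, DecidableEq (m i)] [CommRing R] {M : ∀ i, Matrix (m i) (m i) R}
    (h : ∀ i, IsUnit (M i)) : IsUnit (blockDiagonal' M) :=
  (Pi.isUnit_iff.2 h).map (blockDiagonal'RingHom m R)

theorem blockDiagonal'_mul_diagonal_mul_conjTranspose {o R : Type*} {m : o → Type*} [Fintype o]
    [DecidableEq o] [∀ i, Fintype (m i)] [∀ i, DecidableEq (m i)] [DecidableEq ((i : o) × m i)]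
    [CommRing R] [StarRing R] (S : ∀ i, Matrix (m i) (m i) R) (e : (i : o) × m i → R) :
    blockDiagonal' (fun j => S j * diagonal (fun i => e ⟨j, i⟩) * (S j)ᴴ) =
      blockDiagonal' S * diagonal e * (blockDiagonal' S)ᴴ := by
  have hdiag : diagonal e = blockDiagonal' fun j => diagonal fun i => e ⟨j, i⟩ := by
    rw [blockDiagonal'_diagonal]
    congr!
  rw [blockDiagonal'_mul, blockDiagonal'_mul, ← blockDiagonal'_conjTranspose, hdiag]

theorem star_dotProduct_diagonal_mulVec {ι : Type*} [Fintype ι] [DecidableEq ι] (d : ι → ℝ)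
    (x : ι → ℂ) : star x ⬝ᵥ (diagonal (fun i => (d i : ℂ)) *ᵥ x) =
      ((∑ i, d i * ‖x i‖ ^ 2 : ℝ) : ℂ) := by
  simp only [dotProduct, mulVec_diagonal, Pi.star_apply, RCLike.star_def, Complex.ofReal_sum]
  refine Finset.sum_congr rfl fun i _ => ?_
  rw [mul_left_comm, Complex.conj_mul']
  push_cast
  ring

/-- A real diagonal solution of the strict Stein inequality is nonsingular. -/
theorem ne_zero_of_posDef_diagonal_stein {ι : Type*} [Fintype ι] [DecidableEq ι] {d : ι → ℝ}
    {M : Matrix ι ι ℂ}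
    (h : (diagonal (fun i => (d i : ℂ)) - M * diagonal (fun i => (d i : ℂ)) * Mᴴ).PosDef)
    (i : ι) : d i ≠ 0 := by
  let f : ({i // d i ≤ 0} → ℂ) →ₗ[ℂ] ({i // d i < 0} → ℂ) :=
    (Mᴴ.submatrix (Subtype.val : {i // d i < 0} → ι) (Subtype.val : {i // d i ≤ 0} → ι)).mulVecLin
  have hf : Function.Injective f := by
    rw [← LinearMap.ker_eq_bot, LinearMap.ker_eq_bot']
    intro y hy
    by_contra hy0
    let x : ι → ℂ := fun i => if hi : d i ≤ 0 then y ⟨i, hi⟩ else 0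
    have hx0 : x ≠ 0 := fun hx => hy0 <| funext fun j => by
      simpa [x, j.2] using congrFun hx j
    have hfx : ∀ j, d j < 0 → (Mᴴ *ᵥ x) j = 0 := by
      intro j hj
      rw [← show f y ⟨j, hj⟩ = 0 from congrFun hy _]
      simp only [f, mulVecLin_apply, mulVec, dotProduct, submatrix_apply]
      have hy' : ∀ k : {i // d i ≤ 0}, y k = x k := fun k => by simp [x, k.2]
      simp only [hy']
      rw [← Finset.sum_subtype (Finset.univ.filter (d · ≤ 0)) (by simp)
        (fun i => Mᴴ j i * x i), Finset.sum_filter]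
      refine Finset.sum_congr rfl fun i _ => ?_
      split_ifs with hi <;> simp [x, hi]
    have key := h.dotProduct_mulVec_pos hx0
    have hMx : star x ⬝ᵥ ((M * diagonal (fun i => (d i : ℂ)) * Mᴴ) *ᵥ x) =
        star (Mᴴ *ᵥ x) ⬝ᵥ (diagonal (fun i => (d i : ℂ)) *ᵥ (Mᴴ *ᵥ x)) := by
      rw [star_mulVec, conjTranspose_conjTranspose, ← dotProduct_mulVec, mulVec_mulVec,
        mulVec_mulVec, mul_assoc]
    rw [sub_mulVec, dotProduct_sub, hMx, star_dotProduct_diagonal_mulVec,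
      star_dotProduct_diagonal_mulVec, ← Complex.ofReal_sub, Complex.zero_lt_real] at key
    have h1 : ∑ i, d i * ‖x i‖ ^ 2 ≤ 0 := Finset.sum_nonpos fun i _ => by
      by_cases hi : d i ≤ 0
      · exact mul_nonpos_of_nonpos_of_nonneg hi (by positivity)
      · simp [x, hi]
    have h2 : 0 ≤ ∑ i, d i * ‖(Mᴴ *ᵥ x) i‖ ^ 2 := Finset.sum_nonneg fun i _ => by
      rcases lt_or_ge (d i) 0 with hi | hi
      · simp [hfx i hi]
      · positivity
    linarith
  have hcard := card_le_of_injective ℂ f hf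
  intro hi
  refine hcard.not_gt (Fintype.card_lt_of_injective_of_notMem
    (fun j : {i // d i < 0} => (⟨j, j.2.le⟩ : {i // d i ≤ 0})) (fun a b hab => ?_)
    (b := ⟨i, hi.le⟩) ?_)
  · simpa [Subtype.ext_iff] using hab
  · rintro ⟨j, hj⟩
    exact j.2.ne ((congrArg d (congrArg Subtype.val hj)).trans hi)

theorem stmt9 {d : ℕ} (nn : Fin d → ℕ) (hnn : ∀ j, 0 < nn j)
    (K : Matrix (BIdx nn) (BIdx nn) ℂ) :
    StructSimStrictContr nn K ↔ ∃ W ∈ WK nn K, W.PosDef := by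
  constructor
  · rintro ⟨S, hS, J, ⟨e, he, rfl⟩, hJ⟩
    refine ⟨_, ⟨fun j => S j * diagonal (fun i => e ⟨j, i⟩) * (S j)ᴴ, fun j => ?_, rfl⟩, ?_⟩
    · refine isHermitian_mul_mul_conjTranspose _ (isHermitian_diagonal_of_self_adjoint _ ?_)
      ext i
      rcases he ⟨j, i⟩ with h | h <;> simp [h]
    · rw [blockDiagonal'_mul_diagonal_mul_conjTranspose]
      exact (posDef_stein_congr _ hS (mul_nonsing_inv_mul_mul K hS)).2 hJ
  · rintro ⟨_, ⟨H, hH, rfl⟩, hW⟩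
    let lam : BIdx nn → ℝ := fun i => (hH i.1).eigenvalues i.2
    let U : ∀ j, Matrix (Fin (nn j)) (Fin (nn j)) ℂ := fun j => (hH j).eigenvectorUnitary
    have hU : ∀ j, IsUnit (U j) := fun j => Unitary.isUnit_coe
    have hHU : ∀ j, H j = U j * diagonal (fun i => (lam ⟨j, i⟩ : ℂ)) * (U j)ᴴ :=
      fun j => (hH j).spectral_theorem
    have hlam : ∀ i, lam i ≠ 0 := by
      have hB := isUnit_blockDiagonal' hU
      refine ne_zero_of_posDef_diagonal_stein
        ((posDef_stein_congr _ hB (mul_nonsing_inv_mul_mul K hB)).1 ?_)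
      rwa [← blockDiagonal'_mul_diagonal_mul_conjTranspose U, ← funext hHU]
    let S : ∀ j, Matrix (Fin (nn j)) (Fin (nn j)) ℂ :=
      fun j => U j * diagonal (fun i => ((√|lam ⟨j, i⟩| : ℝ) : ℂ))
    have hS : IsUnit (blockDiagonal' S) := isUnit_blockDiagonal' fun j =>
      (hU j).mul <| (isUnit_diagonal).2 <| Pi.isUnit_iff.2 fun i => by
        simp [hlam]
    let e : BIdx nn → ℂ := fun i => ((SignType.sign (lam i) : ℝ) : ℂ)
    have hSJ : ∀ j, H j = S j * diagonal (fun i => e ⟨j, i⟩) * (S j)ᴴ := by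
      intro j
      have hd : diagonal (fun i => (lam ⟨j, i⟩ : ℂ)) =
          diagonal (fun i => ((√|lam ⟨j, i⟩| : ℝ) : ℂ)) * diagonal (fun i => e ⟨j, i⟩) *
            (diagonal (fun i => ((√|lam ⟨j, i⟩| : ℝ) : ℂ)))ᴴ := by
        rw [diagonal_conjTranspose, diagonal_mul_diagonal, diagonal_mul_diagonal]
        congr 1
        ext i
        simp only [e, Pi.star_apply, RCLike.star_def, Complex.conj_ofReal]
        rw [mul_right_comm, ← Complex.ofReal_mul, ← Complex.ofReal_mul,
          Real.mul_self_sqrt (abs_nonneg _), abs_mul_sign]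
      rw [hHU j, hd]
      simp only [S, conjTranspose_mul, mul_assoc]
    refine ⟨S, hS, diagonal e, ⟨e, fun i => ?_, rfl⟩, ?_⟩
    · rcases (hlam i).lt_or_gt with h | h
      · right; simp [e, h]
      · left; simp [e, h]
    · rw [← posDef_stein_congr _ hS (mul_nonsing_inv_mul_mul K hS),
        ← blockDiagonal'_mul_diagonal_mul_conjTranspose S, ← funext hSJ]
      exact hW
end

section
/- Let K ∈ ℂ^{n×n} with n = n₁+⋯+n_d and let c ∈ ℂ be nonzero. Suppose L is a nonzero positive semidefinite matrix in 𝒲_K^⊥, factored as L = XX* with X ∈ ℂ^{n×m}, X = col(X₁,…,X_d) with X_j ∈ ℂ^{n_j×m}, and let V₁,…,V_d ∈ ℂ^{m×m} be unitary matrices such that the j-th block of K*X equals X_j V_j for each j. Then c·det(I_n ⊗ I_m − (K ⊗ I_m)(⊕_{j=1}^d I_{n_j} ⊗ V_jᵀ)) = 0. -/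
open Matrix Kronecker
open scoped ComplexOrder

/-- Multiplying a row vector by `K ⊗ I` is multiplication of its matrix form by `Kᵀ`. -/
theorem vecMul_kronecker_one {ι κ : Type*} [Fintype ι] [Fintype κ] [DecidableEq κ]
    (K : Matrix ι ι ℂ) (x : ι × κ → ℂ) (q : ι) (k : κ) :
    (x ᵥ* (K ⊗ₖ (1 : Matrix κ κ ℂ))) (q, k) = ∑ p, x (p, k) * K p q := by
  simp [vecMul, dotProduct, Fintype.sum_prod_type, kroneckerMap_apply, one_apply]

theorem vecMul_oplusKron {d : ℕ} (nn : Fin d → ℕ) {m : ℕ}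
    (U : ∀ _ : Fin d, Matrix (Fin m) (Fin m) ℂ) (x : BIdx nn × Fin m → ℂ)
    (q : BIdx nn) (k : Fin m) :
    (x ᵥ* oplusKron nn U) (q, k) = ∑ l, x (q, l) * U q.1 l k := by
  simp only [vecMul, dotProduct, Fintype.sum_prod_type, oplusKron]
  rw [Finset.sum_eq_single q]
  · simp
  · intro p _ hp
    simp [hp]
  · simp

/-- The entrywise conjugate of `X`, read as a row vector, is fixed by
`(K ⊗ I)(⊕ I ⊗ V_jᵀ)`. -/
theorem vecMul_kronecker_mul_oplusKron {d : ℕ} (nn : Fin d → ℕ)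
    (K : Matrix (BIdx nn) (BIdx nn) ℂ) {m : ℕ} (X : Matrix (BIdx nn) (Fin m) ℂ)
    (V : ∀ _ : Fin d, Matrix (Fin m) (Fin m) ℂ)
    (hV : ∀ j, V j ∈ Matrix.unitaryGroup (Fin m) ℂ)
    (hXV : ∀ j, blk nn (Kᴴ * X) j = blk nn X j * V j) :
    (fun p : BIdx nn × Fin m => star (X p.1 p.2)) ᵥ*
        ((K ⊗ₖ (1 : Matrix (Fin m) (Fin m) ℂ)) * oplusKron nn (fun j => (V j)ᵀ)) =
      fun p => star (X p.1 p.2) := by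
  ext ⟨⟨j, a⟩, k⟩
  have hK : ∀ l, ∑ p, star (X p l) * K p ⟨j, a⟩ = ((blk nn X j * V j)ᴴ) l a := by
    intro l
    rw [← hXV j]
    simp [blk, conjTranspose_apply, mul_apply, mul_comm]
  rw [← vecMul_vecMul, vecMul_oplusKron]
  simp only [vecMul_kronecker_one, hK]
  have hmul : V j * (blk nn X j * V j)ᴴ = (blk nn X j)ᴴ := by
    rw [conjTranspose_mul, ← Matrix.mul_assoc, ← star_eq_conjTranspose (V j),
      mem_unitaryGroup_iff.mp (hV j), Matrix.one_mul]
  have hentry := congrFun (congrFun hmul k) a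
  rw [mul_apply] at hentry
  simpa [mul_comm, blk] using hentry

theorem stmt10 {d : ℕ} (nn : Fin d → ℕ) (hnn : ∀ j, 0 < nn j)
    (K : Matrix (BIdx nn) (BIdx nn) ℂ) (c : ℂ) (hc : c ≠ 0)
    (L : Matrix (BIdx nn) (BIdx nn) ℂ) (hL0 : L ≠ 0)
    (hLperp : L ∈ WKperp nn K) {m : ℕ}
    (X : Matrix (BIdx nn) (Fin m) ℂ) (hLX : L = X * Xᴴ)
    (V : ∀ _ : Fin d, Matrix (Fin m) (Fin m) ℂ)
    (hV : ∀ j, V j ∈ Matrix.unitaryGroup (Fin m) ℂ)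
    (hXV : ∀ j, blk nn (Kᴴ * X) j = blk nn X j * V j) :
    ncDet nn K c (fun j => (V j)ᵀ) = 0 := by
  have hX : X ≠ 0 := by
    rintro rfl
    exact hL0 (by simp [hLX])
  unfold ncDet
  refine mul_eq_zero_of_right c (exists_vecMul_eq_zero_iff.mp
    ⟨fun p => star (X p.1 p.2), fun h => hX ?_, ?_⟩)
  · ext p k
    exact star_eq_zero.mp (congrFun h (p, k))
  · rw [vecMul_sub, vecMul_one, vecMul_kronecker_mul_oplusKron nn K X V hV hXV, sub_self]
end
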